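/- There exists a simple 21-gon with region P ⊆ ℝ² and vertex cycle v 0, …, v 20 such that for every starting index k, some point X outside P is not observed by any guard of the every-second-vertex guard set G_k = {v((k + 2j) mod 21) : 0 ≤ j < 11}. (Hence 21 is an odd number of sides for which placing a guard at every second vertex can always fail.) -/

import Mathlib

/-- A simple `n`-gon in the plane: `n ≥ 3` distinct vertices `v 0, …, v (n-1)`
(indices mod `n`, so indexed by `ZMod n`), whose consecutive edges meet exactly in
their shared endpoint and whose non-consecutive edges are disjoint, together with a
compact region `P` equal to the closure of its interior whose topological frontier
is the union of the edges. -/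
def IsSimplePolygon (n : ℕ) (v : ZMod n → ℝ × ℝ) (P : Set (ℝ × ℝ)) : Prop :=
  3 ≤ n ∧
  Function.Injective v ∧
  (∀ i : ZMod n,
    segment ℝ (v i) (v (i + 1)) ∩ segment ℝ (v (i + 1)) (v (i + 2)) = {v (i + 1)}) ∧
  (∀ i j : ZMod n, j ≠ i → j ≠ i + 1 → i ≠ j + 1 →
    segment ℝ (v i) (v (i + 1)) ∩ segment ℝ (v j) (v (j + 1)) = ∅) ∧
  IsCompact P ∧
  P = closure (interior P) ∧
  frontier P = ⋃ i : ZMod n, segment ℝ (v i) (v (i + 1))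

/-- The every-second-vertex guard set with starting index `k`:
`G_k = {v ((k + 2*j) mod n) : 0 ≤ j < ⌈n/2⌉}`. -/
def EverySecondGuards (n : ℕ) (v : ZMod n → ℝ × ℝ) (k : ZMod n) : Set (ℝ × ℝ) :=
  {p | ∃ j : ℕ, j < (n + 1) / 2 ∧ p = v (k + ((2 * j : ℕ) : ZMod n))}

/-- Twice the signed area of the triangle `p q x`. -/
def cross {R : Type*} [CommRing R] (p q x : R × R) : R :=
  (q.1 - p.1) * (x.2 - p.2) - (q.2 - p.2) * (x.1 - p.1)

/-- The point of the real plane with given integer coordinates. -/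
def realPoint (p : ℤ × ℤ) : ℝ × ℝ := (p.1, p.2)

/-- The vertices of the polygon, listed clockwise. -/
def vertexCoord (i : ZMod 21) : ℤ × ℤ :=
  (![(0, 109), (-30, 59), (-12, 81), (40, 67), (14, 79), (-6, 133), (120, 69),
    (95, -55), (66, -4), (76, -30), (38, -68), (62, -52), (118, -61), (0, -139),
    (-95, -55), (-36, -56), (-64, -51), (-78, 1), (-76, -28), (-112, -72),
    (-120, 69)] : Fin 21 → ℤ × ℤ) i

/-- Three points outside the polygon, each seeing only three of its vertices. -/
def hiddenCoord : Fin 3 → ℤ × ℤ := ![(0, 89), (77, -45), (-77, -45)]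

/-- The vertex indices, listed counterclockwise, of a triangulation of the polygon. -/
def triangleIndex : Fin 19 → Fin 3 → ZMod 21 :=
  ![![8, 7, 6], ![15, 14, 13], ![1, 0, 20], ![3, 2, 1], ![10, 9, 8], ![6, 5, 4],
    ![17, 16, 15], ![20, 19, 18], ![13, 12, 11], ![13, 11, 10], ![15, 13, 10],
    ![15, 10, 8], ![17, 15, 8], ![17, 8, 6], ![20, 18, 17], ![1, 20, 17],
    ![3, 1, 17], ![3, 17, 6], ![3, 6, 4]]

/-- The value at `x` of the linear form supporting the side `s` of the triangle `j`. -/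
def sideForm (j : Fin 19) (s : Fin 3) (x : ℤ × ℤ) : ℤ :=
  cross (vertexCoord (triangleIndex j s)) (vertexCoord (triangleIndex j (s + 1))) x

/-- The vertices of the polygon as points of the real plane. -/
def gonVertex (i : ZMod 21) : ℝ × ℝ := realPoint (vertexCoord i)

/-- The closed triangles of the triangulation. -/
def gonTriangle (j : Fin 19) : Set (ℝ × ℝ) :=
  {x | ∀ s : Fin 3,
    0 ≤ cross (gonVertex (triangleIndex j s)) (gonVertex (triangleIndex j (s + 1))) x}

/-- The region bounded by the polygon. -/
def gonRegion : Set (ℝ × ℝ) := ⋃ j, gonTriangle j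

section Cross

lemma cross_realPoint (p q x : ℤ × ℤ) :
    cross (realPoint p) (realPoint q) (realPoint x) = ((cross p q x : ℤ) : ℝ) := by
  simp [cross, realPoint]

lemma cross_combo (p q x y : ℝ × ℝ) {a b : ℝ} (h : a + b = 1) :
    cross p q (a • x + b • y) = a * cross p q x + b * cross p q y := by
  obtain rfl : a = 1 - b := by linarith
  simp [cross]
  ring

lemma cross_swap (p q x : ℝ × ℝ) : cross q p x = -cross p q x := by
  simp only [cross]; ring

lemma cross_rotate (p q x : ℝ × ℝ) : cross q x p = cross p q x := by
  simp only [cross]; ring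

@[simp] lemma cross_self_left (p q : ℝ × ℝ) : cross p q p = 0 := by
  simp [cross]

@[simp] lemma cross_self_right (p q : ℝ × ℝ) : cross p q q = 0 := by
  simp only [cross]; ring

lemma cross_add_cross_add_cross (p q r x : ℝ × ℝ) :
    cross p q x + cross q r x + cross r p x = cross p q r := by
  simp only [cross]; ring

lemma cross_barycentric (p q r x : ℝ × ℝ) :
    cross p q r • x = cross q r x • p + cross r p x • q + cross p q x • r := by
  ext <;> simp [cross] <;> ring

@[fun_prop]
lemma continuous_cross (p q : ℝ × ℝ) : Continuous (cross p q) := by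
  unfold cross; fun_prop

lemma eq_combo_of_cross_eq_zero {p q r x : ℝ × ℝ} (hD : 0 < cross p q r)
    (h : cross p q x = 0) :
    cross q r x / cross p q r + cross r p x / cross p q r = 1 ∧
      x = (cross q r x / cross p q r) • p + (cross r p x / cross p q r) • q := by
  have hs := cross_add_cross_add_cross p q r x
  have hb := cross_barycentric p q r x
  rw [h] at hs hb
  refine ⟨by rw [← add_div, div_eq_one_iff_eq hD.ne']; linarith, ?_⟩
  rw [zero_smul, add_zero] at hb
  rw [div_eq_inv_mul, div_eq_inv_mul, mul_smul, mul_smul, ← smul_add, ← hb, smul_smul,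
    inv_mul_cancel₀ hD.ne', one_smul]

/-- A half-plane is not a neighbourhood of a point of its boundary line. -/
lemma not_mem_nhds_of_cross_eq_zero {p q x : ℝ × ℝ} (hpq : p ≠ q) (hx : cross p q x = 0) :
    {y | 0 ≤ cross p q y} ∉ nhds x := by
  intro h
  have hc : Filter.Tendsto (fun t : ℝ => x + t • ((q.2 - p.2, p.1 - q.1) : ℝ × ℝ))
      (nhdsWithin 0 (Set.Ioi 0)) (nhds x) := by
    have : Continuous (fun t : ℝ => x + t • ((q.2 - p.2, p.1 - q.1) : ℝ × ℝ)) := by fun_prop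
    simpa using (this.tendsto 0).mono_left nhdsWithin_le_nhds
  obtain ⟨t, ht, ht0⟩ := ((hc.eventually h).and self_mem_nhdsWithin).exists
  have ht0 : 0 < t := ht0
  have hval : cross p q (x + t • ((q.2 - p.2, p.1 - q.1) : ℝ × ℝ)) =
      cross p q x - t * ((q.1 - p.1) ^ 2 + (q.2 - p.2) ^ 2) := by
    simp [cross]; ring
  have ht : 0 ≤ cross p q (x + t • ((q.2 - p.2, p.1 - q.1) : ℝ × ℝ)) := ht
  rw [hval, hx] at ht
  have hsum : (q.1 - p.1) ^ 2 + (q.2 - p.2) ^ 2 ≤ 0 := by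
    by_contra! hlt
    nlinarith [mul_pos ht0 hlt]
  apply hpq
  ext <;> nlinarith [sq_nonneg (q.1 - p.1), sq_nonneg (q.2 - p.2)]

lemma segment_inter_segment_eq_singleton {a b c : ℝ × ℝ} (h : cross a b c ≠ 0) :
    segment ℝ a b ∩ segment ℝ b c = {b} := by
  apply Set.Subset.antisymm
  · rintro x ⟨⟨s, t, -, -, hst, rfl⟩, ⟨u, w, -, -, huw, hx⟩⟩
    have h1 := cross_combo a b a b hst
    rw [← hx, cross_combo a b b c huw] at h1
    have hw : w = 0 := by simpa [h] using h1
    obtain rfl : u = 1 := by linarith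
    simp [← hx, hw]
  · rintro x rfl
    exact ⟨right_mem_segment ℝ a x, left_mem_segment ℝ x c⟩

lemma segment_inter_segment_eq_empty {a b c d : ℝ × ℝ} (h : 0 < cross a b c * cross a b d) :
    segment ℝ a b ∩ segment ℝ c d = ∅ := by
  rw [Set.eq_empty_iff_forall_notMem]
  rintro x ⟨⟨s, t, -, -, hst, rfl⟩, ⟨u, w, hu, hw, huw, hx⟩⟩
  have h1 := cross_combo a b a b hst
  rw [← hx, cross_combo a b c d huw] at h1
  simp only [cross_self_left, cross_self_right, mul_zero, add_zero] at h1
  rcases pos_and_pos_or_neg_and_neg_of_mul_pos h with ⟨hc, hd⟩ | ⟨hc, hd⟩ <;>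
    rcases hu.eq_or_lt with rfl | hu <;> nlinarith

end Cross

section Certificates

lemma vertexCoord_injective : Function.Injective vertexCoord := by
  unfold Function.Injective; decide +kernel

lemma cross_consecutive_ne_zero :
    ∀ i, cross (vertexCoord i) (vertexCoord (i + 1)) (vertexCoord (i + 2)) ≠ 0 := by
  decide +kernel

lemma edges_separated : ∀ i j : ZMod 21, j ≠ i → j ≠ i + 1 → i ≠ j + 1 →
    0 < cross (vertexCoord i) (vertexCoord (i + 1)) (vertexCoord j) *
        cross (vertexCoord i) (vertexCoord (i + 1)) (vertexCoord (j + 1)) ∨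
    0 < cross (vertexCoord j) (vertexCoord (j + 1)) (vertexCoord i) *
        cross (vertexCoord j) (vertexCoord (j + 1)) (vertexCoord (i + 1)) := by
  decide +kernel

lemma sideForm_opposite_pos :
    ∀ j s, 0 < sideForm j s (vertexCoord (triangleIndex j (s + 2))) := by
  decide +kernel

lemma side_is_edge_or_shared : ∀ j s,
    triangleIndex j s = triangleIndex j (s + 1) + 1 ∨
    ∃ j' s', triangleIndex j' s' = triangleIndex j (s + 1) ∧
      triangleIndex j' (s' + 1) = triangleIndex j s := by
  decide +kernel

lemma edge_is_side : ∀ i, ∃ j s, triangleIndex j s = i + 1 ∧ triangleIndex j (s + 1) = i := by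
  decide +kernel

/-- An edge of the polygon is a side of a given triangle, or a Farkas certificate shows that
its relative interior misses the triangle. -/
lemma edge_is_side_or_separated : ∀ i j,
    (∃ s, triangleIndex j s = i + 1 ∧ triangleIndex j (s + 1) = i) ∨
    (∃ s, sideForm j s (vertexCoord i) ≤ 0 ∧ sideForm j s (vertexCoord (i + 1)) ≤ 0 ∧
      sideForm j s (vertexCoord i) + sideForm j s (vertexCoord (i + 1)) < 0) ∨
    (∃ s s', 0 ≤ sideForm j s (vertexCoord (i + 1)) ∧
      sideForm j s' (vertexCoord (i + 1)) ≤ 0 ∧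
      sideForm j s (vertexCoord (i + 1)) * sideForm j s' (vertexCoord i) <
        sideForm j s (vertexCoord i) * sideForm j s' (vertexCoord (i + 1))) := by
  decide +kernel

lemma exists_sideForm_hidden_neg : ∀ k j, ∃ s, sideForm j s (hiddenCoord k) < 0 := by
  decide +kernel

/-- For every starting index some hidden point is separated from all guards: one of the points
dividing the segment in ratio `1 : 1` or `2 : 3` is interior to a triangle. -/
lemma exists_hidden_blocked : ∀ k : ZMod 21, ∃ m : Fin 3, ∀ l : Fin 11, ∃ j : Fin 19,
    ∃ b : Bool, ∀ s, 0 < (if b then 3 else 1) * sideForm j s (hiddenCoord m) +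
      (if b then 2 else 1) * sideForm j s (vertexCoord (k + ((2 * (l : ℕ) : ℕ) : ZMod 21))) := by
  decide +kernel

end Certificates

section Triangles

lemma gonVertex_injective : Function.Injective gonVertex := by
  intro i j h
  apply vertexCoord_injective
  simpa [gonVertex, realPoint, Prod.ext_iff] using h

lemma cross_gonVertex (j : Fin 19) (s : Fin 3) (x : ℤ × ℤ) :
    cross (gonVertex (triangleIndex j s)) (gonVertex (triangleIndex j (s + 1))) (realPoint x) =
      ((sideForm j s x : ℤ) : ℝ) :=
  cross_realPoint _ _ _

lemma cross_triangle_pos (j : Fin 19) (s : Fin 3) :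
    0 < cross (gonVertex (triangleIndex j s)) (gonVertex (triangleIndex j (s + 1)))
      (gonVertex (triangleIndex j (s + 2))) := by
  have h := sideForm_opposite_pos j s
  rw [gonVertex.eq_1 (triangleIndex j (s + 2)), cross_gonVertex]
  exact_mod_cast h

lemma mem_gonTriangle_iff (j : Fin 19) (s : Fin 3) (x : ℝ × ℝ) :
    x ∈ gonTriangle j ↔
      0 ≤ cross (gonVertex (triangleIndex j s)) (gonVertex (triangleIndex j (s + 1))) x ∧
      0 ≤ cross (gonVertex (triangleIndex j (s + 1))) (gonVertex (triangleIndex j (s + 2))) x ∧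
      0 ≤ cross (gonVertex (triangleIndex j (s + 2))) (gonVertex (triangleIndex j s)) x := by
  fin_cases s <;> simp [gonTriangle, Fin.forall_fin_succ] <;> tauto

lemma isClosed_gonTriangle (j : Fin 19) : IsClosed (gonTriangle j) := by
  simp only [gonTriangle, Set.ofPred_forall]
  exact isClosed_iInter fun s => isClosed_le continuous_const (continuous_cross _ _)

lemma convex_gonTriangle (j : Fin 19) : Convex ℝ (gonTriangle j) := by
  intro x hx y hy a b ha hb hab s
  rw [cross_combo _ _ _ _ hab]
  exact add_nonneg (mul_nonneg ha (hx s)) (mul_nonneg hb (hy s))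

lemma gonVertex_mem_gonTriangle (j : Fin 19) (s : Fin 3) :
    gonVertex (triangleIndex j s) ∈ gonTriangle j := by
  rw [mem_gonTriangle_iff j s]
  refine ⟨by simp, ?_, by simp⟩
  rw [cross_rotate]
  exact (cross_triangle_pos j s).le

lemma mem_interior_gonTriangle {j : Fin 19} {x : ℝ × ℝ}
    (h : ∀ s, 0 < cross (gonVertex (triangleIndex j s)) (gonVertex (triangleIndex j (s + 1))) x) :
    x ∈ interior (gonTriangle j) := by
  refine mem_interior.2 ⟨{y | ∀ s, 0 < cross (gonVertex (triangleIndex j s))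
    (gonVertex (triangleIndex j (s + 1))) y}, fun y hy s => (hy s).le, ?_, h⟩
  simp only [Set.ofPred_forall]
  exact isOpen_iInter_of_finite fun s => isOpen_lt continuous_const (continuous_cross _ _)

lemma gonTriangle_subset_convexHull (j : Fin 19) :
    gonTriangle j ⊆ convexHull ℝ (Set.range gonVertex) := by
  intro x hx
  obtain ⟨h1, h2, h3⟩ := (mem_gonTriangle_iff j 0 x).1 hx
  have hD := cross_triangle_pos j 0
  set p := gonVertex (triangleIndex j 0) with hp
  set q := gonVertex (triangleIndex j (0 + 1)) with hq
  set r := gonVertex (triangleIndex j (0 + 2)) with hr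
  have hmem : ∀ i, gonVertex i ∈ convexHull ℝ (Set.range gonVertex) := fun i =>
    subset_convexHull ℝ _ (Set.mem_range_self i)
  have hs := cross_add_cross_add_cross p q r x
  have key : x = (cross q r x / cross p q r) • p + (cross r p x / cross p q r) • q +
      (cross p q x / cross p q r) • r := by
    rw [div_eq_inv_mul, div_eq_inv_mul, div_eq_inv_mul, mul_smul, mul_smul, mul_smul,
      ← smul_add, ← smul_add, ← cross_barycentric, smul_smul, inv_mul_cancel₀ hD.ne', one_smul]
  have hsum := (convex_convexHull ℝ (Set.range gonVertex)).sum_mem (t := Finset.univ)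
    (w := ![cross q r x / cross p q r, cross r p x / cross p q r, cross p q x / cross p q r])
    (z := ![p, q, r]) ?_ ?_ ?_
  · rw [key]
    simpa [Fin.sum_univ_three] using hsum
  · intro i _
    fin_cases i <;> simp <;> positivity
  · simp only [Fin.sum_univ_three, Matrix.cons_val]
    rw [← add_div, ← add_div, div_eq_one_iff_eq hD.ne']
    linarith
  · intro i _
    fin_cases i <;> exact hmem _

lemma gonTriangle_subset_closure_interior (j : Fin 19) :
    gonTriangle j ⊆ closure (interior (gonTriangle j)) := by
  have hne : (interior (gonTriangle j)).Nonempty := by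
    refine ⟨(1 / 3 : ℝ) • gonVertex (triangleIndex j 0) +
      (2 / 3 : ℝ) • ((1 / 2 : ℝ) • gonVertex (triangleIndex j 1) +
        (1 / 2 : ℝ) • gonVertex (triangleIndex j 2)), mem_interior_gonTriangle fun s => ?_⟩
    rw [cross_combo _ _ _ _ (by norm_num), cross_combo _ _ _ _ (by norm_num)]
    have h := cross_triangle_pos j s
    fin_cases s <;> simp at h ⊢ <;> linarith
  rw [(convex_gonTriangle j).closure_interior_eq_closure_of_nonempty_interior hne]
  exact subset_closure

end Triangles

section Region

lemma gonTriangle_subset_gonRegion (j : Fin 19) : gonTriangle j ⊆ gonRegion :=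
  Set.subset_iUnion gonTriangle j

lemma isClosed_gonRegion : IsClosed gonRegion :=
  isClosed_iUnion_of_finite isClosed_gonTriangle

lemma isCompact_gonRegion : IsCompact gonRegion :=
  (Set.finite_range gonVertex).isCompact_convexHull ℝ |>.of_isClosed_subset isClosed_gonRegion
    (Set.iUnion_subset gonTriangle_subset_convexHull)

lemma gonRegion_eq_closure_interior : gonRegion = closure (interior gonRegion) := by
  apply Set.Subset.antisymm
  · exact Set.iUnion_subset fun j => (gonTriangle_subset_closure_interior j).trans
      (closure_mono (interior_mono (gonTriangle_subset_gonRegion j)))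
  · exact closure_minimal interior_subset isClosed_gonRegion

/-- Points of a common side of two triangles, other than its endpoints, are interior to
the region. -/
lemma mem_interior_of_shared_side {j j' : Fin 19} {s s' : Fin 3} {x : ℝ × ℝ}
    (h1 : triangleIndex j' s' = triangleIndex j (s + 1))
    (h2 : triangleIndex j' (s' + 1) = triangleIndex j s)
    (hx : x ∈ openSegment ℝ (gonVertex (triangleIndex j s))
      (gonVertex (triangleIndex j (s + 1)))) :
    x ∈ interior gonRegion := by
  have hj := mem_gonTriangle_iff j s
  have hj' := mem_gonTriangle_iff j' s'
  have hD := cross_triangle_pos j s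
  have hD' := cross_triangle_pos j' s'
  rw [h1, h2] at hj' hD'
  set p := gonVertex (triangleIndex j s)
  set q := gonVertex (triangleIndex j (s + 1))
  set r := gonVertex (triangleIndex j (s + 2))
  set r' := gonVertex (triangleIndex j' (s' + 2))
  refine mem_interior.2 ⟨{y | 0 < cross q r y} ∩ {y | 0 < cross r p y} ∩
    ({y | 0 < cross p r' y} ∩ {y | 0 < cross r' q y}), ?_, ?_, ?_⟩
  · rintro y ⟨⟨ha, hb⟩, hc, hd⟩
    rcases le_total 0 (cross p q y) with h | h
    · exact gonTriangle_subset_gonRegion j ((hj y).2 ⟨h, le_of_lt ha, le_of_lt hb⟩)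
    · refine gonTriangle_subset_gonRegion j' ((hj' y).2 ⟨?_, le_of_lt hc, le_of_lt hd⟩)
      rw [cross_swap]
      linarith
  · have hopen : ∀ a b : ℝ × ℝ, IsOpen {y | 0 < cross a b y} := fun a b =>
      isOpen_lt continuous_const (continuous_cross a b)
    exact ((hopen _ _).inter (hopen _ _)).inter ((hopen _ _).inter (hopen _ _))
  · obtain ⟨a, b, ha, hb, hab, rfl⟩ := hx
    simp only [Set.mem_inter_iff, Set.mem_ofPred_eq, cross_combo _ _ _ _ hab,
      cross_self_left, cross_self_right, mul_zero, add_zero, zero_add]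
    rw [cross_rotate q r p, cross_rotate p q r, cross_rotate p r' q, cross_rotate q p r']
    exact ⟨⟨mul_pos ha hD, mul_pos hb hD⟩, mul_pos hb hD', mul_pos ha hD'⟩

lemma mem_interior_or_mem_edge {x : ℝ × ℝ} (hx : x ∈ gonRegion) :
    x ∈ interior gonRegion ∨ ∃ i, x ∈ segment ℝ (gonVertex i) (gonVertex (i + 1)) := by
  obtain ⟨j, hj⟩ := Set.mem_iUnion.1 hx
  by_cases hall : ∀ s, 0 < cross (gonVertex (triangleIndex j s))
      (gonVertex (triangleIndex j (s + 1))) x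
  · exact .inl (interior_mono (gonTriangle_subset_gonRegion j) (mem_interior_gonTriangle hall))
  push Not at hall
  obtain ⟨s, hs⟩ := hall
  obtain ⟨h1, h2, h3⟩ := (mem_gonTriangle_iff j s x).1 hj
  have hD := cross_triangle_pos j s
  obtain ⟨hsum, hcomb⟩ := eq_combo_of_cross_eq_zero hD (le_antisymm hs h1)
  have ha := div_nonneg h2 hD.le
  have hb := div_nonneg h3 hD.le
  rcases side_is_edge_or_shared j s with he | ⟨j', s', e1, e2⟩
  · refine .inr ⟨triangleIndex j (s + 1), ?_⟩
    rw [← he, segment_symm]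
    exact ⟨_, _, ha, hb, hsum, hcomb.symm⟩
  · rcases ha.eq_or_lt with ha | ha
    · refine .inr ⟨triangleIndex j (s + 1), ?_⟩
      rw [← ha, zero_add] at hsum
      rw [← ha, hsum, zero_smul, one_smul, zero_add] at hcomb
      rw [hcomb]
      exact left_mem_segment _ _ _
    rcases hb.eq_or_lt with hb | hb
    · refine .inr ⟨triangleIndex j s, ?_⟩
      rw [← hb, add_zero] at hsum
      rw [← hb, hsum, zero_smul, one_smul, add_zero] at hcomb
      rw [hcomb]
      exact left_mem_segment _ _ _
    exact .inl (mem_interior_of_shared_side e1 e2 ⟨_, _, ha, hb, hsum, hcomb.symm⟩)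

lemma edge_is_side_or_notMem {i : ZMod 21} {x : ℝ × ℝ}
    (hx : x ∈ openSegment ℝ (gonVertex i) (gonVertex (i + 1))) (j : Fin 19) :
    (∃ s, triangleIndex j s = i + 1 ∧ triangleIndex j (s + 1) = i) ∨ x ∉ gonTriangle j := by
  obtain ⟨a, b, ha, hb, hab, rfl⟩ := hx
  have hval : ∀ s, a • gonVertex i + b • gonVertex (i + 1) ∈ gonTriangle j →
      0 ≤ a * (sideForm j s (vertexCoord i) : ℝ) +
        b * (sideForm j s (vertexCoord (i + 1)) : ℝ) := by
    intro s h
    have := h s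
    rwa [cross_combo _ _ _ _ hab, gonVertex.eq_1 i, gonVertex.eq_1 (i + 1), cross_gonVertex,
      cross_gonVertex] at this
  rcases edge_is_side_or_separated i j with h | ⟨s, h1, h2, h3⟩ | ⟨s, s', h1, h2, h3⟩
  · exact .inl h
  · refine .inr fun hmem => ?_
    have h := hval s hmem
    have h1 : (sideForm j s (vertexCoord i) : ℝ) ≤ 0 := by exact_mod_cast h1
    have h2 : (sideForm j s (vertexCoord (i + 1)) : ℝ) ≤ 0 := by exact_mod_cast h2
    have h3 : (sideForm j s (vertexCoord i) : ℝ) +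
      (sideForm j s (vertexCoord (i + 1)) : ℝ) < 0 := by exact_mod_cast h3
    have e1 : a * (sideForm j s (vertexCoord i) : ℝ) = 0 := by nlinarith
    have e2 : b * (sideForm j s (vertexCoord (i + 1)) : ℝ) = 0 := by nlinarith
    rw [mul_eq_zero_iff_left ha.ne'] at e1
    rw [mul_eq_zero_iff_left hb.ne'] at e2
    linarith
  · refine .inr fun hmem => ?_
    have h := hval s hmem
    have h' := hval s' hmem
    have h1 : (0 : ℝ) ≤ sideForm j s (vertexCoord (i + 1)) := by exact_mod_cast h1
    have h2 : (sideForm j s' (vertexCoord (i + 1)) : ℝ) ≤ 0 := by exact_mod_cast h2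
    have h3 : (sideForm j s (vertexCoord (i + 1)) : ℝ) * sideForm j s' (vertexCoord i) <
        sideForm j s (vertexCoord i) * sideForm j s' (vertexCoord (i + 1)) := by
      exact_mod_cast h3
    have e1 := mul_nonneg h1 h'
    have e2 := mul_nonneg (neg_nonneg.2 h2) h
    have e3 := mul_pos ha (sub_pos.2 h3)
    linarith

lemma notMem_interior_of_mem_openSegment {i : ZMod 21} {x : ℝ × ℝ}
    (hx : x ∈ openSegment ℝ (gonVertex i) (gonVertex (i + 1))) : x ∉ interior gonRegion := by
  intro hxint
  have hne : gonVertex (i + 1) ≠ gonVertex i :=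
    gonVertex_injective.ne (by simpa using (by decide : (1 : ZMod 21) ≠ 0))
  have hzero : cross (gonVertex (i + 1)) (gonVertex i) x = 0 := by
    obtain ⟨a, b, -, -, hab, rfl⟩ := hx
    simp [cross_combo _ _ _ _ hab]
  refine not_mem_nhds_of_cross_eq_zero hne hzero ?_
  have hfar : ∀ᶠ y in nhds x, ∀ j, x ∉ gonTriangle j → y ∉ gonTriangle j :=
    Filter.eventually_all.2 fun j => by
      by_cases h : x ∈ gonTriangle j
      · exact .of_forall fun y hy => absurd h hy
      · filter_upwards [(isClosed_gonTriangle j).isOpen_compl.mem_nhds h] with y hy _ using hy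
  filter_upwards [mem_interior_iff_mem_nhds.1 hxint, hfar] with y hy hyfar
  obtain ⟨j, hj⟩ := Set.mem_iUnion.1 hy
  rcases edge_is_side_or_notMem hx j with ⟨s, h1, h2⟩ | h
  · have := hj s
    rwa [h1, h2] at this
  · exact absurd hj (hyfar j h)

lemma edge_subset_gonRegion (i : ZMod 21) :
    segment ℝ (gonVertex i) (gonVertex (i + 1)) ⊆ gonRegion := by
  obtain ⟨j, s, h1, h2⟩ := edge_is_side i
  have m1 := gonVertex_mem_gonTriangle j s
  have m2 := gonVertex_mem_gonTriangle j (s + 1)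
  rw [h1] at m1
  rw [h2] at m2
  exact ((convex_gonTriangle j).segment_subset m2 m1).trans (gonTriangle_subset_gonRegion j)

lemma frontier_gonRegion :
    frontier gonRegion = ⋃ i, segment ℝ (gonVertex i) (gonVertex (i + 1)) := by
  rw [isClosed_gonRegion.frontier_eq]
  apply Set.Subset.antisymm
  · rintro x ⟨hx, hxint⟩
    exact Set.mem_iUnion.2 ((mem_interior_or_mem_edge hx).resolve_left hxint)
  · refine Set.iUnion_subset fun i x hx => ⟨edge_subset_gonRegion i hx, ?_⟩
    have hsub : closure (openSegment ℝ (gonVertex i) (gonVertex (i + 1))) ⊆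
        (interior gonRegion)ᶜ :=
      closure_minimal (fun y hy => notMem_interior_of_mem_openSegment hy)
        isOpen_interior.isClosed_compl
    rw [closure_openSegment] at hsub
    exact hsub hx

lemma isSimplePolygon_gonRegion : IsSimplePolygon 21 gonVertex gonRegion := by
  refine ⟨by norm_num, gonVertex_injective, fun i => ?_, fun i j h1 h2 h3 => ?_,
    isCompact_gonRegion, gonRegion_eq_closure_interior, frontier_gonRegion⟩
  · apply segment_inter_segment_eq_singleton
    rw [gonVertex, gonVertex, gonVertex, cross_realPoint]
    exact_mod_cast cross_consecutive_ne_zero i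
  · rcases edges_separated i j h1 h2 h3 with h | h
    · apply segment_inter_segment_eq_empty
      simp only [gonVertex, cross_realPoint]
      exact_mod_cast h
    · rw [Set.inter_comm]
      apply segment_inter_segment_eq_empty
      simp only [gonVertex, cross_realPoint]
      exact_mod_cast h

lemma hidden_notMem_gonRegion (k : Fin 3) : realPoint (hiddenCoord k) ∉ gonRegion := by
  intro h
  obtain ⟨j, hj⟩ := Set.mem_iUnion.1 h
  obtain ⟨s, hs⟩ := exists_sideForm_hidden_neg k j
  have := hj s
  rw [cross_gonVertex] at this
  have : 0 ≤ sideForm j s (hiddenCoord k) := by exact_mod_cast this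
  omega

lemma segment_inter_interior_nonempty {x y : ℤ × ℤ} {j : Fin 19} {a b : ℤ} (ha : 0 < a)
    (hb : 0 < b) (h : ∀ s, 0 < a * sideForm j s x + b * sideForm j s y) :
    (segment ℝ (realPoint x) (realPoint y) ∩ interior gonRegion).Nonempty := by
  have ha : (0 : ℝ) < a := by exact_mod_cast ha
  have hb : (0 : ℝ) < b := by exact_mod_cast hb
  have hab : (a / (a + b) + b / (a + b) : ℝ) = 1 := by field_simp
  refine ⟨(a / (a + b) : ℝ) • realPoint x + (b / (a + b) : ℝ) • realPoint y,
    ⟨_, _, by positivity, by positivity, hab, rfl⟩,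
    interior_mono (gonTriangle_subset_gonRegion j) (mem_interior_gonTriangle fun s => ?_)⟩
  have hs : (0 : ℝ) < a * sideForm j s x + b * sideForm j s y := by exact_mod_cast h s
  rw [cross_combo _ _ _ _ hab, cross_gonVertex, cross_gonVertex, div_mul_eq_mul_div,
    div_mul_eq_mul_div, ← add_div]
  positivity

end Region

/-- There is a simple 21-gon such that for every starting index the
every-second-vertex guard placement fails: some exterior point is seen by no guard. -/
theorem exists_twentyone_gon_guards_fail :
    ∃ (v : ZMod 21 → ℝ × ℝ) (P : Set (ℝ × ℝ)), IsSimplePolygon 21 v P ∧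
      ∀ k : ZMod 21, ∃ X : ℝ × ℝ, X ∉ P ∧
        ∀ g ∈ EverySecondGuards 21 v k, (segment ℝ X g ∩ interior P).Nonempty := by
  refine ⟨gonVertex, gonRegion, isSimplePolygon_gonRegion, fun k => ?_⟩
  obtain ⟨m, hm⟩ := exists_hidden_blocked k
  refine ⟨realPoint (hiddenCoord m), hidden_notMem_gonRegion m, ?_⟩
  rintro g ⟨l, hl, rfl⟩
  obtain ⟨j, b, h⟩ := hm ⟨l, hl⟩
  exact segment_inter_interior_nonempty (by split <;> norm_num) (by split <;> norm_num) h
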